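/- arXiv:2602.01159 — 2 statements merged into one kernel-verified Lean document; each statement's English description precedes it below -/
import Mathlib

section
/- Fix 0 < c < 1 and define f_c(θ) = π·F_c(θ/π + 1/2) − π/2, g_c(θ) = −f_c(−θ), a_c(θ,φ) = cos²φ·cos²f_c(θ) / (cos²φ·cos²f_c(θ) + sin²φ·cos²g_c(θ)), and ρ_c(θ,φ) = a_c(θ,φ)·sin f_c(θ) + (1 − a_c(θ,φ))·sin g_c(θ). Then for every θ₀ ∈ (−π/2, π/2) and every φ₀ ∈ ℝ, the total (Fréchet) derivative of the map (θ, φ) ↦ ρ_c(θ, φ) at (θ₀, φ₀) is nonzero. (This is the content of Lemma 4.6: the only equilibrium points of the body K(c,d) = {λ(cos θ cos φ, cos θ sin φ, sin θ) : 0 ≤ λ ≤ R(1 + d·ρ_c(θ,φ))} with respect to the origin, for any 0 < d < 1, are the two poles R_{c,d}(0,0,±1)·(0,0,±1), since away from the poles the gradient of the radial function never vanishes.) -/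
open Real

/-- The function `F_c` of the Várkonyi–Domokos construction. -/
noncomputable def Fc (c x : ℝ) : ℝ :=
  (c * x^2 + (1 - c) * (1 - x)^2 * (c * x / (c + x))) / (c * x + (1 - c) * (1 - x)^2)

noncomputable def fc (c θ : ℝ) : ℝ := π * Fc c (θ / π + 1/2) - π / 2

noncomputable def gc (c θ : ℝ) : ℝ := - fc c (-θ)

noncomputable def ac (c θ φ : ℝ) : ℝ :=
  cos φ ^ 2 * cos (fc c θ) ^ 2 /
    (cos φ ^ 2 * cos (fc c θ) ^ 2 + sin φ ^ 2 * cos (gc c θ) ^ 2)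

noncomputable def rhoc (c θ φ : ℝ) : ℝ :=
  ac c θ φ * sin (fc c θ) + (1 - ac c θ φ) * sin (gc c θ)

theorem Fc_denom_pos {c x : ℝ} (hc0 : 0 < c) (hc1 : c < 1) (hx0 : 0 < x) :
    0 < c * x + (1 - c) * (1 - x) ^ 2 := by
  have : 0 < 1 - c := sub_pos.2 hc1
  positivity

theorem Fc_pos {c x : ℝ} (hc0 : 0 < c) (hc1 : c < 1) (hx0 : 0 < x) : 0 < Fc c x := by
  have : 0 < 1 - c := sub_pos.2 hc1
  have := Fc_denom_pos hc0 hc1 hx0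
  unfold Fc
  positivity

theorem Fc_lt_self {c x : ℝ} (hc0 : 0 < c) (hc1 : c < 1) (hx0 : 0 < x) (hx1 : x < 1) :
    Fc c x < x := by
  have h1 : 0 < 1 - c := sub_pos.2 hc1
  have h2 : 0 < 1 - x := sub_pos.2 hx1
  have h3 : c * x / (c + x) < x := by
    rw [div_lt_iff₀ (by positivity)]
    nlinarith
  have h4 : (1 - c) * (1 - x) ^ 2 * (c * x / (c + x)) < (1 - c) * (1 - x) ^ 2 * x := by
    gcongr
  rw [Fc, div_lt_iff₀ (Fc_denom_pos hc0 hc1 hx0)]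
  linarith

theorem exists_hasDerivAt_Fc_pos {c x : ℝ} (hc0 : 0 < c) (hc1 : c < 1) (hx0 : 0 < x)
    (hx1 : x < 1) : ∃ m, 0 < m ∧ HasDerivAt (Fc c) m x := by
  have h1 : 0 < 1 - c := sub_pos.2 hc1
  have h2 : 0 < 1 - x := sub_pos.2 hx1
  have hcx : 0 < c + x := by positivity
  have hD := Fc_denom_pos hc0 hc1 hx0
  have hp : HasDerivAt (fun y : ℝ => c * y) c x := by
    simpa using (hasDerivAt_id x).const_mul c
  have hq : HasDerivAt (fun y : ℝ => (1 - c) * (1 - y) ^ 2) (-(2 * (1 - c) * (1 - x))) x := by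
    refine ((((hasDerivAt_id' x).const_sub 1).fun_pow 2).const_mul (1 - c)).congr_deriv ?_
    norm_num
    ring
  have hr : HasDerivAt (fun y : ℝ => c * y / (c + y)) (c ^ 2 / (c + x) ^ 2) x := by
    refine (hp.fun_div ((hasDerivAt_id' x).const_add c) hcx.ne').congr_deriv ?_
    ring
  have hs : HasDerivAt (fun y : ℝ => c * y ^ 2) (2 * c * x) x := by
    refine (((hasDerivAt_id' x).fun_pow 2).const_mul c).congr_deriv ?_
    norm_num
    ring
  refine ⟨_, ?_, (hs.add (hq.mul hr)).div (hp.add hq) hD.ne'⟩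
  have key : 0 < (c * x + (1 - c) * (1 - x) ^ 2) *
        (c * x + (1 - c) * (1 - x) ^ 2 * (c ^ 2 / (c + x) ^ 2)) +
      (c * ((1 - c) * (1 - x) ^ 2) + c * x * (2 * (1 - c) * (1 - x))) * (x ^ 2 / (c + x)) := by
    positivity
  refine div_pos (key.trans_eq ?_) (pow_pos hD 2)
  simp only [Pi.add_apply, Pi.mul_apply]
  field_simp
  ring

theorem angle_normalized_mem {θ : ℝ} (hθ : θ ∈ Set.Ioo (-(π / 2)) (π / 2)) :
    0 < θ / π + 1 / 2 ∧ θ / π + 1 / 2 < 1 := by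
  have h : θ / π * π = θ := div_mul_cancel₀ θ pi_pos.ne'
  constructor <;> nlinarith [hθ.1, hθ.2, pi_pos]

theorem fc_lt_self {c θ : ℝ} (hc0 : 0 < c) (hc1 : c < 1)
    (hθ : θ ∈ Set.Ioo (-(π / 2)) (π / 2)) : fc c θ < θ := by
  obtain ⟨h0, h1⟩ := angle_normalized_mem hθ
  have h : θ / π * π = θ := div_mul_cancel₀ θ pi_pos.ne'
  have := Fc_lt_self hc0 hc1 h0 h1
  unfold fc
  nlinarith [pi_pos]

theorem fc_mem {c θ : ℝ} (hc0 : 0 < c) (hc1 : c < 1)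
    (hθ : θ ∈ Set.Ioo (-(π / 2)) (π / 2)) : fc c θ ∈ Set.Ioo (-(π / 2)) (π / 2) := by
  refine ⟨?_, (fc_lt_self hc0 hc1 hθ).trans hθ.2⟩
  have := mul_pos pi_pos (Fc_pos hc0 hc1 (angle_normalized_mem hθ).1)
  unfold fc
  linarith

theorem neg_mem_Ioo_neg {a θ : ℝ} (hθ : θ ∈ Set.Ioo (-a) a) : -θ ∈ Set.Ioo (-a) a :=
  ⟨by linarith [hθ.2], by linarith [hθ.1]⟩

theorem gc_mem {c θ : ℝ} (hc0 : 0 < c) (hc1 : c < 1)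
    (hθ : θ ∈ Set.Ioo (-(π / 2)) (π / 2)) : gc c θ ∈ Set.Ioo (-(π / 2)) (π / 2) :=
  neg_mem_Ioo_neg (fc_mem hc0 hc1 (neg_mem_Ioo_neg hθ))

theorem fc_lt_gc {c θ : ℝ} (hc0 : 0 < c) (hc1 : c < 1)
    (hθ : θ ∈ Set.Ioo (-(π / 2)) (π / 2)) : fc c θ < gc c θ := by
  have h1 := fc_lt_self hc0 hc1 hθ
  have h2 := fc_lt_self hc0 hc1 (neg_mem_Ioo_neg hθ)
  unfold gc
  linarith

theorem exists_hasDerivAt_fc_pos {c θ : ℝ} (hc0 : 0 < c) (hc1 : c < 1)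
    (hθ : θ ∈ Set.Ioo (-(π / 2)) (π / 2)) : ∃ m, 0 < m ∧ HasDerivAt (fc c) m θ := by
  obtain ⟨h0, h1⟩ := angle_normalized_mem hθ
  obtain ⟨m, hm, hF⟩ := exists_hasDerivAt_Fc_pos hc0 hc1 h0 h1
  have hl : HasDerivAt (fun t : ℝ => t / π + 1 / 2) (1 / π) θ :=
    ((hasDerivAt_id θ).div_const π).add_const _
  refine ⟨π * (m * (1 / π)), by positivity, ?_⟩
  exact ((hF.comp θ hl).const_mul π).sub_const _

theorem exists_hasDerivAt_gc_pos {c θ : ℝ} (hc0 : 0 < c) (hc1 : c < 1)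
    (hθ : θ ∈ Set.Ioo (-(π / 2)) (π / 2)) : ∃ m, 0 < m ∧ HasDerivAt (gc c) m θ := by
  obtain ⟨m, hm, hf⟩ := exists_hasDerivAt_fc_pos hc0 hc1 (neg_mem_Ioo_neg hθ)
  refine ⟨m, hm, ?_⟩
  exact (hf.comp θ (hasDerivAt_neg θ)).neg.congr_deriv (by ring)

theorem ac_denom_pos {a b : ℝ} (φ : ℝ) (ha : 0 < a) (hb : 0 < b) :
    0 < cos φ ^ 2 * a ^ 2 + sin φ ^ 2 * b ^ 2 := by
  rcases eq_or_ne (cos φ) 0 with h | h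
  · have : sin φ ^ 2 = 1 := by nlinarith [sin_sq_add_cos_sq φ]
    rw [h, this]
    positivity
  · positivity

theorem differentiableAt_rhoc {c θ : ℝ} (φ : ℝ) (hc0 : 0 < c) (hc1 : c < 1)
    (hθ : θ ∈ Set.Ioo (-(π / 2)) (π / 2)) :
    DifferentiableAt ℝ (fun p : ℝ × ℝ => rhoc c p.1 p.2) (θ, φ) := by
  obtain ⟨_, -, hf'⟩ := exists_hasDerivAt_fc_pos hc0 hc1 hθ
  obtain ⟨_, -, hg'⟩ := exists_hasDerivAt_gc_pos hc0 hc1 hθ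
  have hf : DifferentiableAt ℝ (fun p : ℝ × ℝ => fc c p.1) (θ, φ) :=
    DifferentiableAt.comp (θ, φ) (g := fc c) (f := Prod.fst) hf'.differentiableAt
      differentiableAt_fst
  have hg : DifferentiableAt ℝ (fun p : ℝ × ℝ => gc c p.1) (θ, φ) :=
    DifferentiableAt.comp (θ, φ) (g := gc c) (f := Prod.fst) hg'.differentiableAt
      differentiableAt_fst
  have hden := (ac_denom_pos φ (cos_pos_of_mem_Ioo (fc_mem hc0 hc1 hθ))
    (cos_pos_of_mem_Ioo (gc_mem hc0 hc1 hθ))).ne'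
  have ha : DifferentiableAt ℝ (fun p : ℝ × ℝ => ac c p.1 p.2) (θ, φ) := by
    have hP : DifferentiableAt ℝ (fun p : ℝ × ℝ => cos p.2 ^ 2 * cos (fc c p.1) ^ 2) (θ, φ) := by
      fun_prop
    have hQ : DifferentiableAt ℝ (fun p : ℝ × ℝ => sin p.2 ^ 2 * cos (gc c p.1) ^ 2) (θ, φ) := by
      fun_prop
    simpa only [ac, div_eq_mul_inv] using hP.fun_mul ((hP.fun_add hQ).fun_inv hden)
  unfold rhoc
  fun_prop

theorem hasDerivAt_rhoc_right {c θ : ℝ} (φ : ℝ) (hf : 0 < cos (fc c θ)) (hg : 0 < cos (gc c θ)) :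
    HasDerivAt (fun t => rhoc c θ t)
      (2 * sin φ * cos φ * cos (fc c θ) ^ 2 * cos (gc c θ) ^ 2 *
        (sin (gc c θ) - sin (fc c θ)) /
        (cos φ ^ 2 * cos (fc c θ) ^ 2 + sin φ ^ 2 * cos (gc c θ) ^ 2) ^ 2) φ := by
  have hD := (ac_denom_pos φ hf hg).ne'
  have hP := ((hasDerivAt_cos φ).pow 2).mul_const (cos (fc c θ) ^ 2)
  have hQ := ((hasDerivAt_sin φ).pow 2).mul_const (cos (gc c θ) ^ 2)
  have ha : HasDerivAt (fun t => ac c θ t) _ φ := hP.div (hP.add hQ) hD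
  refine ((ha.mul_const (sin (fc c θ))).add
    ((ha.const_sub 1).mul_const (sin (gc c θ)))).congr_deriv ?_
  simp only [Pi.pow_apply]
  field_simp
  rw [show sin (gc c θ) - sin (fc c θ) =
    (sin φ ^ 2 + cos φ ^ 2) * (sin (gc c θ) - sin (fc c θ)) by rw [sin_sq_add_cos_sq, one_mul]]
  push_cast
  ring

theorem rhoc_of_sin_eq_zero {c θ φ : ℝ} (hφ : sin φ = 0) (hf : cos (fc c θ) ≠ 0) :
    rhoc c θ φ = sin (fc c θ) := by
  have hφ' : cos φ ≠ 0 := by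
    intro h
    simpa [h, hφ] using sin_sq_add_cos_sq φ
  have : ac c θ φ = 1 := by
    simp [ac, hφ, hf, hφ']
  simp [rhoc, this]

theorem rhoc_of_cos_eq_zero {c θ φ : ℝ} (hφ : cos φ = 0) : rhoc c θ φ = sin (gc c θ) := by
  simp [rhoc, ac, hφ]

/-- The content of Lemma 4.6: for `0 < c < 1`, the total derivative of
`(θ, φ) ↦ ρ_c(θ, φ)` is nonzero at every point `(θ₀, φ₀)` with `θ₀ ∈ (−π/2, π/2)`. -/
theorem stmt_12 (c : ℝ) (hc0 : 0 < c) (hc1 : c < 1)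
    (θ₀ φ₀ : ℝ) (hθ : θ₀ ∈ Set.Ioo (-(π/2)) (π/2)) :
    fderiv ℝ (fun p : ℝ × ℝ => rhoc c p.1 p.2) (θ₀, φ₀) ≠ 0 := by
  intro h0
  have hd := (differentiableAt_rhoc φ₀ hc0 hc1 hθ).hasFDerivAt
  rw [h0] at hd
  have hθd : HasDerivAt (fun t => rhoc c t φ₀) 0 θ₀ := by
    exact hd.comp_hasDerivAt θ₀ ((hasDerivAt_id θ₀).prodMk (hasDerivAt_const θ₀ φ₀))
  have hφd : HasDerivAt (fun t => rhoc c θ₀ t) 0 φ₀ := by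
    exact hd.comp_hasDerivAt φ₀ ((hasDerivAt_const φ₀ θ₀).prodMk (hasDerivAt_id φ₀))
  have hf := fc_mem hc0 hc1 hθ
  have hg := gc_mem hc0 hc1 hθ
  have hcf := cos_pos_of_mem_Ioo hf
  have hcg := cos_pos_of_mem_Ioo hg
  rcases eq_or_ne (sin φ₀) 0 with hs | hs
  · obtain ⟨m, hm, hfm⟩ := exists_hasDerivAt_fc_pos hc0 hc1 hθ
    have heq : (fun t => rhoc c t φ₀) =ᶠ[nhds θ₀] fun t => sin (fc c t) := by
      filter_upwards [Ioo_mem_nhds hθ.1 hθ.2] with t ht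
      exact rhoc_of_sin_eq_zero hs (cos_pos_of_mem_Ioo (fc_mem hc0 hc1 ht)).ne'
    exact (mul_pos hcf hm).ne' (hfm.sin.unique (hθd.congr_of_eventuallyEq heq.symm))
  rcases eq_or_ne (cos φ₀) 0 with hc | hc
  · obtain ⟨m, hm, hgm⟩ := exists_hasDerivAt_gc_pos hc0 hc1 hθ
    simp only [rhoc_of_cos_eq_zero hc] at hθd
    exact (mul_pos hcg hm).ne' (hgm.sin.unique hθd)
  · have hlt : sin (fc c θ₀) < sin (gc c θ₀) :=
      sin_lt_sin_of_lt_of_le_pi_div_two hf.1.le hg.2.le (fc_lt_gc hc0 hc1 hθ)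
    have hD := ac_denom_pos φ₀ hcf hcg
    refine absurd ((hasDerivAt_rhoc_right φ₀ hcf hcg).unique hφd) (div_ne_zero ?_ (by positivity))
    have := (sub_pos.2 hlt).ne'
    positivity
end

section
/- Fix θ ∈ (−π/2, π/2) and φ ∈ ℝ. Then ρ_c(θ, φ) tends to ρ₀(θ, φ) := ((π/2 − θ)⁴ sin²φ − (π/2 + θ)⁴ cos²φ) / ((π/2 + θ)⁴ cos²φ + (π/2 − θ)⁴ sin²φ) as c → 0⁺, i.e. the limit of c ↦ ρ_c(θ,φ) as c tends to 0 from within (0,1) is ρ₀(θ,φ). (This pointwise limit is used, via Lebesgue's dominated convergence theorem and the bound |ρ_c| ≤ 1, in the proofs of Lemma 4.7 and Lemma 4.11.) -/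
open Real Filter

/-- The pointwise limit `ρ₀` of `ρ_c` as `c → 0⁺`. -/
noncomputable def rho0 (θ φ : ℝ) : ℝ :=
  ((π/2 - θ)^4 * sin φ ^ 2 - (π/2 + θ)^4 * cos φ ^ 2) /
    ((π/2 + θ)^4 * cos φ ^ 2 + (π/2 - θ)^4 * sin φ ^ 2)

/-- For `x ∈ (0, 1)`, `F_c(x) ~ c (x² + (1 - x)²) / (1 - x)²` as `c → 0⁺`. -/
lemma tendsto_Fc_div (x : ℝ) (hx : x ∈ Set.Ioo (0:ℝ) 1) :
    Tendsto (fun c => Fc c x / c) (nhdsWithin 0 (Set.Ioo (0:ℝ) 1))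
      (nhds ((x^2 + (1 - x)^2) / (1 - x)^2)) := by
  obtain ⟨h0, h1⟩ := hx
  have h1' : 1 - x ≠ 0 := by linarith
  have key : ContinuousAt (fun c : ℝ => (x^2 + (1 - c) * (1 - x)^2 * (x / (c + x))) /
      (c * x + (1 - c) * (1 - x)^2)) 0 := by
    refine ContinuousAt.div (ContinuousAt.add continuousAt_const (ContinuousAt.mul (by fun_prop)
      (ContinuousAt.div continuousAt_const (by fun_prop) ?_))) (by fun_prop) ?_
    · simpa using h0.ne'
    · simpa using h1'
  have hval : (x^2 + (1 - (0:ℝ)) * (1 - x)^2 * (x / (0 + x))) / (0 * x + (1 - 0) * (1 - x)^2) =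
      (x^2 + (1 - x)^2) / (1 - x)^2 := by
    simp [h0.ne']
  rw [← hval]
  refine (key.tendsto.mono_left nhdsWithin_le_nhds).congr' ?_
  filter_upwards [self_mem_nhdsWithin] with c hc
  have hc0 : c ≠ 0 := hc.1.ne'
  rw [Fc, div_right_comm]
  congr 1
  rw [eq_div_iff hc0]
  ring

lemma tendsto_id_nhdsWithin_Ioo :
    Tendsto (fun c : ℝ => c) (nhdsWithin 0 (Set.Ioo (0:ℝ) 1)) (nhds 0) :=
  tendsto_id.mono_left nhdsWithin_le_nhds

lemma tendsto_Fc (x : ℝ) (hx : x ∈ Set.Ioo (0:ℝ) 1) :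
    Tendsto (fun c => Fc c x) (nhdsWithin 0 (Set.Ioo (0:ℝ) 1)) (nhds 0) := by
  have h := (tendsto_Fc_div x hx).mul tendsto_id_nhdsWithin_Ioo
  rw [mul_zero] at h
  refine h.congr' ?_
  filter_upwards [self_mem_nhdsWithin] with c hc
  exact div_mul_cancel₀ _ hc.1.ne'

lemma div_pi_add_half_mem_Ioo {θ : ℝ} (hθ : θ ∈ Set.Ioo (-(π/2)) (π/2)) :
    θ / π + 1/2 ∈ Set.Ioo (0:ℝ) 1 := by
  have h : θ / π + 1/2 = (θ + π/2) / π := by field_simp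
  rw [h]
  exact ⟨div_pos (by linarith [hθ.1]) pi_pos, (div_lt_one pi_pos).2 (by linarith [hθ.2])⟩

lemma tendsto_sin_fc (θ : ℝ) (hθ : θ ∈ Set.Ioo (-(π/2)) (π/2)) :
    Tendsto (fun c => sin (fc c θ)) (nhdsWithin 0 (Set.Ioo (0:ℝ) 1)) (nhds (-1)) := by
  have h : Tendsto (fun c => fc c θ) (nhdsWithin 0 (Set.Ioo (0:ℝ) 1)) (nhds (π * 0 - π/2)) :=
    ((tendsto_Fc _ (div_pi_add_half_mem_Ioo hθ)).const_mul π).sub_const (π/2)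
  have h' := (continuous_sin.tendsto _).comp h
  have hv : sin (π * 0 - π/2) = -1 := by simp
  rwa [hv] at h'

lemma tendsto_cos_fc_div (θ : ℝ) (hθ : θ ∈ Set.Ioo (-(π/2)) (π/2)) :
    Tendsto (fun c => cos (fc c θ) / c) (nhdsWithin 0 (Set.Ioo (0:ℝ) 1))
      (nhds (π * (((π/2 + θ)^2 + (π/2 - θ)^2) / (π/2 - θ)^2))) := by
  have hx := div_pi_add_half_mem_Ioo hθ
  have hF := (tendsto_Fc _ hx).const_mul π
  rw [mul_zero] at hF
  have hs := (continuous_sinc.tendsto 0).comp hF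
  rw [sinc_zero] at hs
  have h := ((tendsto_Fc_div _ hx).const_mul π).mul hs
  have hv : ((θ / π + 1/2)^2 + (1 - (θ / π + 1/2))^2) / (1 - (θ / π + 1/2))^2 =
      ((π/2 + θ)^2 + (π/2 - θ)^2) / (π/2 - θ)^2 := by
    have e1 : θ / π + 1/2 = (π/2 + θ) / π := by field_simp; ring
    have e2 : 1 - (θ / π + 1/2) = (π/2 - θ) / π := by field_simp; ring
    rw [e2, e1, div_pow, div_pow, ← add_div, div_div_div_cancel_right₀ (pow_ne_zero 2 pi_ne_zero)]
  rw [mul_one, hv] at h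
  refine h.congr fun c => ?_
  have hsin : ∀ u : ℝ, u * sinc u = sin u := fun u => by
    by_cases hu : u = 0
    · simp [hu]
    · rw [sinc_of_ne_zero hu, mul_div_cancel₀ _ hu]
  rw [fc, cos_sub_pi_div_two, ← hsin, Function.comp_apply]
  ring

/-- The pointwise limit of `ρ_c(θ, φ)` as `c → 0⁺` from within `(0,1)` is `ρ₀(θ, φ)`. -/
theorem stmt_15 (θ φ : ℝ) (hθ : θ ∈ Set.Ioo (-(π/2)) (π/2)) :
    Tendsto (fun c => rhoc c θ φ) (nhdsWithin 0 (Set.Ioo (0:ℝ) 1))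
      (nhds (rho0 θ φ)) := by
  have hθ' : -θ ∈ Set.Ioo (-(π/2)) (π/2) := ⟨by linarith [hθ.2], by linarith [hθ.1]⟩
  have hp : 0 < π/2 + θ := by linarith [hθ.1]
  have hm : 0 < π/2 - θ := by linarith [hθ.2]
  have hsf := tendsto_sin_fc θ hθ
  have hsg := (tendsto_sin_fc (-θ) hθ').neg
  have hcf := ((tendsto_cos_fc_div θ hθ).pow 2).const_mul (cos φ ^ 2)
  have hcg := ((tendsto_cos_fc_div (-θ) hθ').pow 2).const_mul (sin φ ^ 2)
  rw [sub_neg_eq_add, ← sub_eq_add_neg] at hcg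
  set P := π/2 + θ with hP
  set M := π/2 - θ with hM
  have hD : 0 < P^4 * cos φ ^ 2 + M^4 * sin φ ^ 2 := by
    rcases eq_or_ne (cos φ) 0 with h | h
    · have hs : sin φ ^ 2 = 1 := by nlinarith [sin_sq_add_cos_sq φ]
      rw [h, hs]; positivity
    · positivity
  have hπ := pi_pos
  have hK : 0 < π^2 * (P^2 + M^2)^2 / (P^4 * M^4) := by positivity
  have e1 : cos φ ^ 2 * (π * ((P^2 + M^2) / M^2))^2 =
      (P^4 * cos φ ^ 2) * (π^2 * (P^2 + M^2)^2 / (P^4 * M^4)) := by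
    field_simp
  have e2 : sin φ ^ 2 * (π * ((M^2 + P^2) / P^2))^2 =
      (M^4 * sin φ ^ 2) * (π^2 * (P^2 + M^2)^2 / (P^4 * M^4)) := by
    field_simp; ring
  rw [e1] at hcf
  rw [e2] at hcg
  have ha := hcf.div (hcf.add hcg) (by rw [← add_mul]; exact (mul_pos hD hK).ne')
  rw [← add_mul, mul_div_mul_right _ _ hK.ne'] at ha
  have hac : Tendsto (fun c => ac c θ φ) (nhdsWithin 0 (Set.Ioo (0:ℝ) 1))
      (nhds (P^4 * cos φ ^ 2 / (P^4 * cos φ ^ 2 + M^4 * sin φ ^ 2))) := by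
    refine ha.congr' ?_
    filter_upwards [self_mem_nhdsWithin] with c hc
    have hc2 : c^2 ≠ 0 := pow_ne_zero 2 hc.1.ne'
    rw [ac, gc, cos_neg, Pi.div_apply, div_pow, div_pow, ← mul_div_assoc, ← mul_div_assoc, ← add_div,
      div_div_div_cancel_right₀ hc2]
  have h := (hac.mul hsf).add ((hac.const_sub 1).mul hsg)
  have hv : P^4 * cos φ ^ 2 / (P^4 * cos φ ^ 2 + M^4 * sin φ ^ 2) * (-1) +
      (1 - P^4 * cos φ ^ 2 / (P^4 * cos φ ^ 2 + M^4 * sin φ ^ 2)) * (- -1) = rho0 θ φ := by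
    rw [rho0, ← hP, ← hM]
    have hD' := hD.ne'
    field_simp
    ring
  rw [hv] at h
  refine h.congr fun c => ?_
  rw [rhoc, gc, sin_neg]
end
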